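/- Let m ≥ 2 and n ≥ 2m, and let U_n be the presented group defined below with distinguished central element z. Set ū = t₁ t₃ t₅ ⋯ t_{2m−1} (the product of the odd-indexed generators t₁, t₃, …, t_{2m−1}) and x̄ = t₂ t₁ t₂ t₃ t₂ t₃ in U_n. Then the commutator [ū, x̄] = ū⁻¹ x̄⁻¹ ū x̄ equals z. (Under the homomorphism λ : U_n → S_n, ū maps to the permutation (1 2)(3 4)⋯(2m−1 2m) and x̄ maps to (1 3)(2 4).) -/

import Mathlib

/-- The free-group generator `z` of Schur's presentation. -/
def zgen (n : ℕ) : FreeGroup (Unit ⊕ Fin (n - 1)) := FreeGroup.of (Sum.inl ())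

/-- The free-group generator `tᵢ` (for `i = 1, …, n-1`, zero-indexed) of Schur's
presentation. -/
def tgen (n : ℕ) (i : Fin (n - 1)) : FreeGroup (Unit ⊕ Fin (n - 1)) :=
  FreeGroup.of (Sum.inr i)

/-- The relators of Schur's presentation of a generalized representation group `Uₙ` of `Sₙ`:
`z² = 1`; `z tᵢ = tᵢ z`; `tᵢ² = z`; `(tᵢ t_{i+1})³ = z`; and `tᵢ tⱼ = z tⱼ tᵢ` for
`|i - j| ≥ 2`. -/
def schurRels (n : ℕ) : Set (FreeGroup (Unit ⊕ Fin (n - 1))) :=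
  {r | r = zgen n ^ 2
    ∨ (∃ i, r = zgen n * tgen n i * (zgen n)⁻¹ * (tgen n i)⁻¹)
    ∨ (∃ i, r = tgen n i ^ 2 * (zgen n)⁻¹)
    ∨ (∃ i j : Fin (n - 1), (i : ℕ) + 1 = (j : ℕ) ∧ r = (tgen n i * tgen n j) ^ 3 * (zgen n)⁻¹)
    ∨ (∃ i j : Fin (n - 1), ((i : ℕ) + 2 ≤ (j : ℕ) ∨ (j : ℕ) + 2 ≤ (i : ℕ)) ∧
        r = tgen n i * tgen n j * (zgen n * tgen n j * tgen n i)⁻¹)}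

/-- Schur's generalized representation group `Uₙ` of `Sₙ`, given by the presentation
`schurRels n`. -/
abbrev SchurCover (n : ℕ) := PresentedGroup (schurRels n)

/-- The distinguished central element `z` of `Uₙ`. -/
def zU (n : ℕ) : SchurCover n := PresentedGroup.of (Sum.inl ())

/-- The generator `tᵢ` of `Uₙ` (zero-indexed). -/
def tU (n : ℕ) (i : Fin (n - 1)) : SchurCover n := PresentedGroup.of (Sum.inr i)

/-- The transposition `(i, i+1)` of `Sₙ` (zero-indexed). -/
def transpo (n : ℕ) (i : Fin (n - 1)) : Equiv.Perm (Fin n) :=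
  Equiv.swap ⟨i.1, by have := i.2; omega⟩ ⟨i.1 + 1, by have := i.2; omega⟩

section CentralInvolution

variable {G : Type*} [Group G] {z : G}

/-- If `a` and `b` square to a central involution `z` and `(ab)³ = z`, then they satisfy the braid
relation. -/
lemma braid_of_sq_eq_central {a b : G} (hz : ∀ g, Commute z g) (hz2 : z * z = 1)
    (ha : a * a = z) (hb : b * b = z) (hab : (a * b) ^ 3 = z) : a * b * a = b * a * b := by
  have h : a * b * a * (b * a * b) = b * a * b * (b * a * b) := by
    calc a * b * a * (b * a * b) = (a * b) ^ 3 := by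
          simp only [pow_succ, pow_zero, one_mul, mul_assoc]
      _ = z * z * z := by rw [hab, hz2, one_mul]
      _ = b * (z * z) * b := by rw [hz2, mul_one, hb, one_mul]
      _ = b * (a * a * z) * b := by rw [ha]
      _ = b * (a * (z * a)) * b := by rw [(hz a).eq, ← mul_assoc a]
      _ = b * a * b * (b * a * b) := by rw [← hb]; group
  exact mul_right_cancel h

/-- An element that commutes with `s` and `s'` up to the same central involution commutes with
their product. -/
lemma commute_mul_of_commute_up_to_central {t s s' : G} (hz : ∀ g, Commute z g)
    (hz2 : z * z = 1) (h : t * s = z * s * t) (h' : t * s' = z * s' * t) :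
    Commute t (s * s') := by
  calc t * (s * s') = z * s * (t * s') := by rw [← mul_assoc, h, mul_assoc]
    _ = z * (s * z) * s' * t := by rw [h']; group
    _ = z * z * s * s' * t := by rw [← (hz s).eq]; group
    _ = s * s' * t := by rw [hz2, one_mul]

/-- If `a`, `b`, `c` satisfy the defining relations of Schur's cover of `S₄`, then conjugation by
`babcbc` swaps `a` and `c`, so that it multiplies `ac` by `z`. -/
lemma mul_braid_word {a b c : G} (hz : ∀ g, Commute z g) (hz2 : z * z = 1)
    (hb : b * b = z) (hab : a * b * a = b * a * b) (hbc : b * c * b = c * b * c)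
    (hac : a * c = z * c * a) :
    a * c * (b * a * b * c * b * c) = b * a * b * c * b * c * (a * c) * z := by
  have hca : c * a = z * a * c := by
    rw [mul_assoc, hac, mul_assoc, ← mul_assoc, hz2, one_mul]
  have hx : b * a * b * c * b * c = z * (b * a * c * b) := by
    calc b * a * b * c * b * c = b * a * b * (c * b * c) := by group
      _ = b * a * (b * b) * c * b := by rw [← hbc]; group
      _ = b * a * c * b * z := by
        rw [hb, ← (hz (b * a)).eq, ← (hz _).eq]; group
      _ = z * (b * a * c * b) := (hz _).eq.symm
  have h₁ : a * (b * a * c * b) = b * a * c * b * c := by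
    calc a * (b * a * c * b) = (a * b * a) * c * b := by group
      _ = b * a * (b * c * b) := by rw [hab]; group
      _ = b * a * c * b * c := by rw [hbc]; group
  have h₂ : c * (b * a * c * b) = b * a * c * b * a := by
    calc c * (b * a * c * b) = c * b * (a * c) * b := by group
      _ = (c * b) * z * (c * a * b) := by rw [hac]; group
      _ = z * ((c * b * c) * a * b) := by rw [← (hz (c * b)).eq]; group
      _ = z * (b * c * (b * a * b)) := by rw [← hbc]; group
      _ = z * b * (c * a) * b * a := by rw [← hab]; group
      _ = z * (b * z) * (a * c * b * a) := by rw [hca]; group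
      _ = z * z * (b * a * c * b * a) := by rw [← (hz b).eq]; group
      _ = b * a * c * b * a := by rw [hz2, one_mul]
  have h₃ : a * c * (b * a * c * b) = b * a * c * b * (a * c) * z := by
    calc a * c * (b * a * c * b) = a * (b * a * c * b) * a := by rw [mul_assoc, h₂]; group
      _ = b * a * c * b * (c * a) := by rw [h₁, mul_assoc]
      _ = b * a * c * b * (z * (a * c)) := by rw [hca, mul_assoc z]
      _ = b * a * c * b * (a * c) * z := by rw [(hz _).eq, ← mul_assoc]
  rw [hx, ← mul_assoc, ← (hz (a * c)).eq, mul_assoc, h₃]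
  group

end CentralInvolution

namespace SchurCover

variable {n : ℕ}

lemma zU_mul_self : zU n * zU n = 1 := by
  have h := PresentedGroup.one_of_mem (rels := schurRels n) (x := zgen n ^ 2) (Or.inl rfl)
  rwa [map_pow, pow_two] at h

lemma zU_mul_tU (i : Fin (n - 1)) : zU n * tU n i = tU n i * zU n := by
  have h := PresentedGroup.one_of_mem (rels := schurRels n) (Or.inr (Or.inl ⟨i, rfl⟩))
  rw [← commutatorElement_def, map_commutatorElement, commutatorElement_eq_one_iff_mul_comm] at h
  exact h

lemma tU_mul_self (i : Fin (n - 1)) : tU n i * tU n i = zU n := by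
  have h := PresentedGroup.one_of_mem (rels := schurRels n) (Or.inr (Or.inr (Or.inl ⟨i, rfl⟩)))
  rwa [map_mul, map_inv, mul_inv_eq_one, map_pow, pow_two] at h

lemma tU_mul_tU_pow_three {i j : Fin (n - 1)} (hij : (i : ℕ) + 1 = j) :
    (tU n i * tU n j) ^ 3 = zU n := by
  have h := PresentedGroup.one_of_mem (rels := schurRels n)
    (Or.inr (Or.inr (Or.inr (Or.inl ⟨i, j, hij, rfl⟩))))
  rwa [map_mul, map_inv, mul_inv_eq_one, map_pow, map_mul] at h

lemma tU_mul_tU_of_far {i j : Fin (n - 1)} (hij : (i : ℕ) + 2 ≤ j ∨ (j : ℕ) + 2 ≤ i) :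
    tU n i * tU n j = zU n * tU n j * tU n i := by
  have h := PresentedGroup.one_of_mem (rels := schurRels n)
    (Or.inr (Or.inr (Or.inr (Or.inr ⟨i, j, hij, rfl⟩))))
  rwa [map_mul, map_inv, mul_inv_eq_one, map_mul, map_mul, map_mul] at h

lemma zU_commute (g : SchurCover n) : Commute (zU n) g := by
  induction g using PresentedGroup.induction_on with
  | _ g =>
    induction g using FreeGroup.induction_on with
    | C1 => exact Commute.one_right _
    | of s =>
      rcases s with u | i
      · exact Commute.refl _
      · exact zU_mul_tU i
    | inv_of s h => rw [map_inv]; exact h.inv_right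
    | mul x y hx hy => rw [map_mul]; exact hx.mul_right hy

lemma tU_braid {i j : Fin (n - 1)} (hij : (i : ℕ) + 1 = j) :
    tU n i * tU n j * tU n i = tU n j * tU n i * tU n j :=
  braid_of_sq_eq_central zU_commute zU_mul_self (tU_mul_self i) (tU_mul_self j)
    (tU_mul_tU_pow_three hij)

end SchurCover

open SchurCover

/-- Let `m ≥ 2` and `n ≥ 2m`. In `Uₙ`, set
`ū = t₁ t₃ ⋯ t_{2m-1}` (zero-indexed: indices `0, 2, …, 2m-2`) and
`x̄ = t₂ t₁ t₂ t₃ t₂ t₃` (zero-indexed: indices `1, 0, 1, 2, 1, 2`). Then the commutator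
`[ū, x̄] = ū⁻¹ x̄⁻¹ ū x̄` equals `z`. -/
theorem commutator_eq_z (m n : ℕ) (hm : 2 ≤ m) (hn : 2 * m ≤ n)
    (ubar xbar : SchurCover n)
    (hu : ubar = ((List.finRange m).map
      (fun i => tU n ⟨2 * i.1, by have := i.2; omega⟩)).prod)
    (hx : xbar = tU n ⟨1, by omega⟩ * tU n ⟨0, by omega⟩ * tU n ⟨1, by omega⟩ *
      tU n ⟨2, by omega⟩ * tU n ⟨1, by omega⟩ * tU n ⟨2, by omega⟩) :
    ubar⁻¹ * xbar⁻¹ * ubar * xbar = zU n := by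
  obtain ⟨k, rfl⟩ := Nat.exists_eq_add_of_le' hm
  have hw : ∀ i : Fin (n - 1), 4 ≤ (i : ℕ) → Commute (tU n i) xbar := by
    intro i hi
    have hpair : ∀ j l : Fin (n - 1), (j : ℕ) ≤ 2 → (l : ℕ) ≤ 2 →
        Commute (tU n i) (tU n j * tU n l) := fun j l hj hl =>
      commute_mul_of_commute_up_to_central zU_commute zU_mul_self
        (tU_mul_tU_of_far (Or.inr (by omega))) (tU_mul_tU_of_far (Or.inr (by omega)))
    rw [hx, mul_assoc _ (tU n ⟨1, _⟩) (tU n ⟨2, _⟩), mul_assoc _ (tU n ⟨1, _⟩) (tU n ⟨2, _⟩)]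
    exact ((hpair _ _ (by simp) (by simp)).mul_right (hpair _ _ (by simp) (by simp))).mul_right
      (hpair _ _ (by simp) (by simp))
  obtain ⟨w, hwx, huw⟩ : ∃ w, Commute w xbar ∧
      ubar = tU n ⟨0, by omega⟩ * tU n ⟨2, by omega⟩ * w := by
    rw [hu, List.finRange_succ, List.finRange_succ]
    simp only [List.map_cons, List.map_map, List.prod_cons, ← mul_assoc]
    refine ⟨_, Commute.list_prod_left _ _ ?_, rfl⟩
    intro y hy
    obtain ⟨i, -, rfl⟩ := List.mem_map.1 hy
    exact hw _ (by simp; omega)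
  have hac := mul_braid_word (a := tU n ⟨0, by omega⟩) (b := tU n ⟨1, by omega⟩)
    (c := tU n ⟨2, by omega⟩) zU_commute zU_mul_self (tU_mul_self _) (tU_braid rfl) (tU_braid rfl)
    (tU_mul_tU_of_far (Or.inl le_rfl))
  rw [← hx] at hac
  have hcomm : ubar * xbar = xbar * ubar * zU n := by
    rw [huw, mul_assoc, hwx.eq, ← mul_assoc, hac, mul_assoc _ (zU n), (zU_commute w).eq]
    simp only [mul_assoc]
  rw [mul_assoc, hcomm]
  group
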